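/- Let H be an elementary abelian 2-hypergroup, G a closed subset of H, and F the Frattini closed subset of G. Then F = {e}. In particular, the Frattini closed subset of H equals {e}. -/

import Mathlib

namespace HyperPaper

/-- A hypergroup: hypermultiplication `hmul`, inversion `star`, identity `e`,
satisfying (H1) associativity, (H2) unique two-sided identity, (H3) exchange conditions. -/
structure Hypergroup (H : Type*) where
  hmul : H → H → Set H
  star : H → H
  e : H
  idl : ∀ p, hmul e p = {p}
  idr : ∀ p, hmul p e = {p}
  e_unique : ∀ e' : H, (∀ p, hmul e' p = {p} ∧ hmul p e' = {p}) → e' = e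
  assoc : ∀ p q r : H, (⋃ x ∈ hmul p q, hmul x r) = ⋃ x ∈ hmul q r, hmul p x
  h3l : ∀ p q r : H, p ∈ hmul q r ↔ q ∈ hmul p (star r)
  h3r : ∀ p q r : H, p ∈ hmul q r ↔ r ∈ hmul (star q) p

variable {H : Type*}

namespace Hypergroup

/-- Product of two subsets: FG = {a : ∃ b ∈ F, c ∈ G, a ∈ bc}. -/
def smul (hg : Hypergroup H) (F G : Set H) : Set H :=
  {a | ∃ b ∈ F, ∃ c ∈ G, a ∈ hg.hmul b c}

/-- Closed subset: nonempty and G*G ⊆ G. -/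
def IsClosed (hg : Hypergroup H) (G : Set H) : Prop :=
  G.Nonempty ∧ hg.smul (hg.star '' G) G ⊆ G

/-- Thin element: p*p = {e}. -/
def IsThin (hg : Hypergroup H) (p : H) : Prop := hg.hmul (hg.star p) p = {hg.e}

/-- Thick element: not thin. -/
def IsThick (hg : Hypergroup H) (p : H) : Prop := ¬ hg.IsThin p

/-- Involution: p ≠ e and {e, p} is closed. -/
def IsInvolution (hg : Hypergroup H) (p : H) : Prop :=
  p ≠ hg.e ∧ hg.IsClosed {hg.e, p}

/-- ⟨G⟩: smallest closed subset containing G. -/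
def gen (hg : Hypergroup H) (G : Set H) : Set H := ⋂₀ {C | hg.IsClosed C ∧ G ⊆ C}

/-- O_ϑ(G): the thin elements of H lying in G. -/
def Othin (hg : Hypergroup H) (G : Set H) : Set H := {p ∈ G | hg.IsThin p}

/-- F is a strongly normal closed subset of G: p*Fp ⊆ F ⊆ G for all p ∈ G. -/
def IsStronglyNormal (hg : Hypergroup H) (F G : Set H) : Prop :=
  hg.IsClosed F ∧ hg.IsClosed G ∧ F ⊆ G ∧
    ∀ p ∈ G, hg.smul (hg.smul {hg.star p} F) {p} ⊆ F

/-- O^ϑ(G): intersection of all strongly normal closed subsets of ⟨G⟩. -/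
def Osup (hg : Hypergroup H) (G : Set H) : Set H :=
  ⋂₀ {F | hg.IsStronglyNormal F (hg.gen G)}

/-- F is a normal closed subset of G. -/
def IsNormal (hg : Hypergroup H) (F G : Set H) : Prop :=
  hg.IsClosed F ∧ hg.IsClosed G ∧ F ⊆ G ∧ ∀ p ∈ G, hg.smul F {p} = hg.smul {p} F

/-- Product of a list of subsets (empty product is {e}). -/
def listProd (hg : Hypergroup H) : List (Set H) → Set H
  | [] => {hg.e}
  | a :: l => hg.smul a (hg.listProd l)

/-- Product r_1 r_2 ⋯ r_n of a family of elements. -/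
def famProd (hg : Hypergroup H) {n : ℕ} (r : Fin n → H) : Set H :=
  hg.listProd ((List.finRange n).map fun i => ({r i} : Set H))

/-- Ĝ_i: the product of the G_j with j ≠ i. -/
def cofactor (hg : Hypergroup H) {n : ℕ} (G : Fin n → Set H) (i : Fin n) : Set H :=
  hg.listProd (((List.finRange n).filter fun j => decide (j ≠ i)).map G)

/-- H is the direct product of the normal closed subsets G_1, …, G_n. -/
def IsDirectProduct (hg : Hypergroup H) {n : ℕ} (G : Fin n → Set H) : Prop :=
  (∀ i, hg.IsNormal (G i) Set.univ) ∧
  (∀ i, hg.smul (G i) (hg.cofactor G i) = Set.univ) ∧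
  (∀ i, G i ∩ hg.cofactor G i = {hg.e})

/-- r : Fin n → H is a decomposition of x with respect to the family G. -/
def IsDecomp (hg : Hypergroup H) {n : ℕ} (G : Fin n → Set H) (x : H) (r : Fin n → H) : Prop :=
  (∀ i, r i ∈ G i) ∧ x ∈ hg.famProd r

/-- The support of x: the elements ≠ e appearing in the decomposition of x. -/
def dsupport (hg : Hypergroup H) {n : ℕ} (G : Fin n → Set H) (x : H) : Set H :=
  {y | y ≠ hg.e ∧ ∃ r, hg.IsDecomp G x r ∧ y ∈ Set.range r}

/-- The cover of x: the product r_1r_2⋯r_n for the decomposition of x. -/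
def dcover (hg : Hypergroup H) {n : ℕ} (G : Fin n → Set H) (x : H) : Set H :=
  {y | ∃ r, hg.IsDecomp G x r ∧ y ∈ hg.famProd r}

/-- x is constrained: its cover equals {x}. -/
def IsConstrained (hg : Hypergroup H) {n : ℕ} (G : Fin n → Set H) (x : H) : Prop :=
  hg.dcover G x = {x}

/-- r_2(G): the largest 2-rank of a thin closed subset of H contained in G
(equivalently, the largest k such that G contains a thin symmetric closed subset
of 2^k elements, which corresponds to an elementary abelian 2-group of 2-rank k). -/
noncomputable def rank2 (hg : Hypergroup H) (G : Set H) : ℕ :=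
  sSup {k | ∃ U : Set H, hg.IsClosed U ∧ U ⊆ G ∧ (∀ u ∈ U, hg.IsThin u) ∧
    (∀ u ∈ U, hg.star u = u) ∧ U.ncard = 2 ^ k}

/-- F is a minimal generating subset of G. -/
def IsMinGen (hg : Hypergroup H) (G F : Set H) : Prop :=
  F ⊆ G ∧ hg.gen F = G ∧ ∀ p ∈ F, hg.gen (F \ {p}) ≠ G

/-- The dimension of G: the smallest cardinality of a minimal generating subset. -/
noncomputable def dimension (hg : Hypergroup H) (G : Set H) : ℕ :=
  sInf {k | ∃ F : Set H, hg.IsMinGen G F ∧ F.Finite ∧ F.ncard = k}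

/-- [F, G] = ⟨{a : ∃ b ∈ F, c ∈ G, a ∈ b*c*bc}⟩. -/
def commSet (hg : Hypergroup H) (F G : Set H) : Set H :=
  hg.gen {a | ∃ b ∈ F, ∃ c ∈ G,
    a ∈ hg.smul (hg.smul (hg.smul {hg.star b} {hg.star c}) {b}) {c}}

/-- derived G k = G^{(k+1)}: G^{(1)} = G, G^{(r)} = [G^{(r-1)}, G]. -/
def derived (hg : Hypergroup H) (G : Set H) : ℕ → Set H
  | 0 => G
  | k + 1 => hg.commSet (hg.derived G k) G

/-- G is nilpotent: G^{(r)} = {e} for some r. -/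
def IsNilpotent (hg : Hypergroup H) (G : Set H) : Prop :=
  ∃ k : ℕ, hg.derived G k = {hg.e}

/-- G is a residually thin closed subset: there is a chain {e} = F_1, …, F_n = G of
pairwise distinct closed subsets, each strongly normal in the next. -/
def IsResiduallyThin (hg : Hypergroup H) (G : Set H) : Prop :=
  ∃ (m : ℕ) (F : Fin (m + 1) → Set H), Function.Injective F ∧
    F 0 = {hg.e} ∧ F (Fin.last m) = G ∧
    ∀ i : Fin m, hg.IsStronglyNormal (F i.castSucc) (F i.succ)

/-- x^k as a subset: x^0 = {e}, x^{k+1} = x^k · x. -/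
def spow (hg : Hypergroup H) (x : H) : ℕ → Set H
  | 0 => {hg.e}
  | k + 1 => hg.smul (hg.spow x k) {x}

/-- F is a maximal closed subset of G. -/
def IsMaximalClosed (hg : Hypergroup H) (F G : Set H) : Prop :=
  hg.IsClosed F ∧ hg.IsClosed G ∧ F ⊆ G ∧ F ≠ G ∧
    ∀ E : Set H, hg.IsClosed E → F ⊆ E → E ⊆ G → E = F ∨ E = G

/-- The Frattini closed subset of G: the intersection (inside G) of all maximal
closed subsets of G. -/
def frattini (hg : Hypergroup H) (G : Set H) : Set H :=
  G ∩ ⋂₀ {F | hg.IsMaximalClosed F G}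

/-- α is an isomorphism from the closed subset F to the closed subset G. -/
def IsIso (hg : Hypergroup H) (F G : Set H) (α : H → H) : Prop :=
  Set.BijOn α F G ∧ α hg.e = hg.e ∧
    ∀ p ∈ F, ∀ q ∈ F, α '' hg.hmul p q = hg.hmul (α p) (α q)

/-- F ≃ G: there is an isomorphism from F to G. -/
def Isomorphic (hg : Hypergroup H) (F G : Set H) : Prop := ∃ α : H → H, hg.IsIso F G α

/-- Aut(G): the automorphism group of G, realized as the subgroup of permutations of G
that fix e and preserve the hypermultiplication. -/
def autGroup (hg : Hypergroup H) (G : Set H) : Subgroup (Equiv.Perm G) where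
  carrier := {σ | (∀ x : G, (x : H) = hg.e → ((σ x : H)) = hg.e) ∧
    ∀ p q x : G, (x : H) ∈ hg.hmul p q ↔ ((σ x : H)) ∈ hg.hmul (σ p) (σ q)}
  one_mem' := by
    constructor
    · intro x hx; simpa using hx
    · intro p q x; simp
  mul_mem' := by
    rintro σ τ ⟨he1, hm1⟩ ⟨he2, hm2⟩
    refine ⟨fun x hx => ?_, fun p q x => ?_⟩
    · simpa using he1 _ (he2 x hx)
    · simpa using (hm2 p q x).trans (hm1 (τ p) (τ q) (τ x))
  inv_mem' := by
    rintro σ ⟨he, hm⟩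
    refine ⟨fun x hx => ?_, fun p q x => ?_⟩
    · have h2 : σ x = x := Subtype.ext ((he x hx).trans hx.symm)
      have h3 : σ⁻¹ x = x := by
        conv_lhs => rw [← h2]
        simp
      rw [h3]; exact hx
    · have h := hm (σ⁻¹ p) (σ⁻¹ q) (σ⁻¹ x)
      simpa using h.symm

end Hypergroup

/-- An elementary abelian 2-hypergroup: a hypergroup that is the constrained direct
product of the closed subsets ⟨q_1⟩, …, ⟨q_n⟩ generated by involutions q_1, …, q_n. -/
structure EA2Data (H : Type*) where
  hg : Hypergroup H
  n : ℕ
  q : Fin n → H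
  invol : ∀ i, hg.IsInvolution (q i)
  dp : hg.IsDirectProduct fun i => hg.gen {q i}
  constrained : ∀ x : H, hg.IsConstrained (fun i => hg.gen {q i}) x

namespace EA2Data

/-- The family ⟨q_1⟩, …, ⟨q_n⟩. -/
def fam (E : EA2Data H) : Fin E.n → Set H := fun i => E.hg.gen {E.q i}

/-- The support of x. -/
def support (E : EA2Data H) (x : H) : Set H := E.hg.dsupport E.fam x

/-- Thick(F): externally thick elements of H lying in F. -/
def ThickIn (E : EA2Data H) (F : Set H) : Set H :=
  {x ∈ F | x = E.hg.e ∨ ∀ y ∈ E.support x, E.hg.IsThick y}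

/-- Thin(F): externally thin elements of H lying in F. -/
def ThinIn (E : EA2Data H) (F : Set H) : Set H :=
  {x ∈ F | x = E.hg.e ∨ ∀ y ∈ E.support x, E.hg.IsThin y}

/-- The (unique) pair (x⁺, x⁻) with x⁺ ∈ Thick(H), x⁻ ∈ Thin(H), x⁺x⁻ = {x}. -/
noncomputable def pm (E : EA2Data H) (x : H) : H × H :=
  @Classical.epsilon (H × H) ⟨(E.hg.e, E.hg.e)⟩ fun z =>
    z.1 ∈ E.ThickIn Set.univ ∧ z.2 ∈ E.ThinIn Set.univ ∧ E.hg.hmul z.1 z.2 = {x}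

/-- x⁺. -/
noncomputable def plus (E : EA2Data H) (x : H) : H := (E.pm x).1

/-- x⁻. -/
noncomputable def minus (E : EA2Data H) (x : H) : H := (E.pm x).2

/-- s(x): the number of thick elements of H in the support of x. -/
noncomputable def sElem (E : EA2Data H) (x : H) : ℕ :=
  {y ∈ E.support x | E.hg.IsThick y}.ncard

/-- s(G) = max {s(a) : a ∈ G}. -/
noncomputable def sSet (E : EA2Data H) (G : Set H) : ℕ :=
  sSup {k | ∃ a ∈ G, E.sElem a = k}

/-- x ⪯ y: the support of x is contained in the support of y. -/
def ple (E : EA2Data H) (x y : H) : Prop := E.support x ⊆ E.support y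

/-- p♯: the number of thick elements among q_1, …, q_n. -/
noncomputable def psharp (E : EA2Data H) : ℕ := {i : Fin E.n | E.hg.IsThick (E.q i)}.ncard

end EA2Data

/-- The Gaussian binomial coefficient C(n, k)_2 with base 2, via the
q-Pascal recurrence C(n, k)_2 = C(n-1, k-1)_2 + 2^k · C(n-1, k)_2. -/
def gaussBinom2 : ℕ → ℕ → ℕ
  | _, 0 => 1
  | 0, _ + 1 => 0
  | n + 1, k + 1 => gaussBinom2 n k + 2 ^ (k + 1) * gaussBinom2 n (k + 1)

end HyperPaper

open HyperPaper

namespace HyperPaper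

namespace Hypergroup

variable {H : Type*} (hg : Hypergroup H)

theorem e_mem_mul_star (p : H) : hg.e ∈ hg.hmul p (hg.star p) :=
  (hg.h3l p hg.e p).1 (by simp [hg.idl])

theorem e_mem_star_mul (p : H) : hg.e ∈ hg.hmul (hg.star p) p :=
  (hg.h3r p p hg.e).1 (by simp [hg.idr])

theorem star_star (p : H) : hg.star (hg.star p) = p := by
  have h := (hg.h3l _ _ _).1 (hg.e_mem_mul_star p)
  rw [hg.idl] at h
  exact h.symm

theorem star_e : hg.star hg.e = hg.e := by
  have h := hg.e_mem_mul_star hg.e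
  rw [hg.idl] at h
  exact h.symm

theorem star_mem_mul {x p q : H} (h : x ∈ hg.hmul p q) :
    hg.star x ∈ hg.hmul (hg.star q) (hg.star p) :=
  (hg.h3l _ _ _).1 ((hg.h3r _ _ _).1 ((hg.h3l _ _ _).1 h))

theorem smul_assoc (A B C : Set H) :
    hg.smul (hg.smul A B) C = hg.smul A (hg.smul B C) := by
  ext x
  constructor
  · rintro ⟨y, ⟨a, ha, b, hb, hy⟩, c, hc, hx⟩
    have h : x ∈ ⋃ y ∈ hg.hmul a b, hg.hmul y c := Set.mem_biUnion hy hx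
    rw [hg.assoc] at h
    obtain ⟨z, hz, hxz⟩ := Set.mem_iUnion₂.1 h
    exact ⟨a, ha, z, ⟨b, hb, c, hc, hz⟩, hxz⟩
  · rintro ⟨a, ha, z, ⟨b, hb, c, hc, hz⟩, hx⟩
    have h : x ∈ ⋃ z ∈ hg.hmul b c, hg.hmul a z := Set.mem_biUnion hz hx
    rw [← hg.assoc] at h
    obtain ⟨y, hy, hxy⟩ := Set.mem_iUnion₂.1 h
    exact ⟨y, ⟨a, ha, b, hb, hy⟩, c, hc, hxy⟩

theorem smul_mono {A B C D : Set H} (h₁ : A ⊆ C) (h₂ : B ⊆ D) :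
    hg.smul A B ⊆ hg.smul C D := by
  rintro x ⟨a, ha, b, hb, hx⟩
  exact ⟨a, h₁ ha, b, h₂ hb, hx⟩

theorem e_smul (A : Set H) : hg.smul {hg.e} A = A := by
  ext x; simp [smul, hg.idl]

theorem smul_e (A : Set H) : hg.smul A {hg.e} = A := by
  ext x; simp [smul, hg.idr]

theorem hmul_nonempty (p q : H) : (hg.hmul p q).Nonempty := by
  have h : p ∈ hg.smul {p} (hg.smul {q} {hg.star q}) :=
    ⟨p, rfl, hg.e, ⟨q, rfl, _, rfl, hg.e_mem_mul_star q⟩, by simp [hg.idr]⟩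
  rw [← smul_assoc] at h
  obtain ⟨y, ⟨a, rfl, b, rfl, hy⟩, -⟩ := h
  exact ⟨y, hy⟩

theorem isClosed_iff {G : Set H} : hg.IsClosed G ↔
    hg.e ∈ G ∧ (∀ x ∈ G, hg.star x ∈ G) ∧ ∀ x ∈ G, ∀ y ∈ G, hg.hmul x y ⊆ G := by
  constructor
  · rintro ⟨⟨x, hx⟩, h⟩
    have h' : ∀ a ∈ G, ∀ b ∈ G, hg.hmul (hg.star a) b ⊆ G :=
      fun a ha b hb z hz => h ⟨_, ⟨a, ha, rfl⟩, b, hb, hz⟩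
    have he : hg.e ∈ G := h' x hx x hx (hg.e_mem_star_mul x)
    have hs : ∀ x ∈ G, hg.star x ∈ G := fun x hx => h' x hx _ he (by simp [hg.idr])
    refine ⟨he, hs, fun x hx y hy => ?_⟩
    have := h' _ (hs x hx) y hy
    rwa [star_star] at this
  · rintro ⟨he, hs, hm⟩
    refine ⟨⟨_, he⟩, ?_⟩
    rintro z ⟨_, ⟨a, ha, rfl⟩, b, hb, hz⟩
    exact hm _ (hs a ha) b hb hz

theorem isClosed_univ : hg.IsClosed (Set.univ : Set H) :=
  ⟨⟨hg.e, trivial⟩, Set.subset_univ _⟩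

variable {hg}

theorem IsClosed.e_mem {G : Set H} (h : hg.IsClosed G) : hg.e ∈ G := (hg.isClosed_iff.1 h).1

theorem IsClosed.star_mem {G : Set H} (h : hg.IsClosed G) {x : H} (hx : x ∈ G) :
    hg.star x ∈ G := (hg.isClosed_iff.1 h).2.1 x hx

theorem IsClosed.mul_mem {G : Set H} (h : hg.IsClosed G) {x y z : H} (hx : x ∈ G) (hy : y ∈ G)
    (hz : z ∈ hg.hmul x y) : z ∈ G := (hg.isClosed_iff.1 h).2.2 x hx y hy hz

theorem IsClosed.smul_subset {G A B : Set H} (h : hg.IsClosed G) (hA : A ⊆ G) (hB : B ⊆ G) :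
    hg.smul A B ⊆ G := by
  rintro z ⟨a, ha, b, hb, hz⟩
  exact h.mul_mem (hA ha) (hB hb) hz

theorem IsClosed.inter {F G : Set H} (hF : hg.IsClosed F) (hG : hg.IsClosed G) :
    hg.IsClosed (F ∩ G) :=
  hg.isClosed_iff.2 ⟨⟨hF.e_mem, hG.e_mem⟩, fun _ hx => ⟨hF.star_mem hx.1, hG.star_mem hx.2⟩,
    fun _ hx _ hy _ hz => ⟨hF.mul_mem hx.1 hy.1 hz, hG.mul_mem hx.2 hy.2 hz⟩⟩

/-- The right cancellation property of closed subsets. -/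
theorem IsClosed.left_mem {G : Set H} (h : hg.IsClosed G) {x y z : H} (hz : z ∈ hg.hmul x y)
    (hzG : z ∈ G) (hy : y ∈ G) : x ∈ G :=
  h.mul_mem hzG (h.star_mem hy) ((hg.h3l _ _ _).1 hz)

/-- The left cancellation property of closed subsets. -/
theorem IsClosed.right_mem {G : Set H} (h : hg.IsClosed G) {x y z : H} (hz : z ∈ hg.hmul x y)
    (hzG : z ∈ G) (hx : x ∈ G) : y ∈ G :=
  h.mul_mem (h.star_mem hx) hzG ((hg.h3r _ _ _).1 hz)

theorem IsNormal.smul_comm {F : Set H} (h : hg.IsNormal F Set.univ) (A : Set H) :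
    hg.smul F A = hg.smul A F := by
  ext x
  constructor
  · rintro ⟨f, hf, a, ha, hx⟩
    have hx' : x ∈ hg.smul F {a} := ⟨f, hf, a, rfl, hx⟩
    rw [h.2.2.2 a trivial] at hx'
    exact hg.smul_mono (Set.singleton_subset_iff.2 ha) subset_rfl hx'
  · rintro ⟨a, ha, f, hf, hx⟩
    have hx' : x ∈ hg.smul {a} F := ⟨a, rfl, f, hf, hx⟩
    rw [← h.2.2.2 a trivial] at hx'
    exact hg.smul_mono subset_rfl (Set.singleton_subset_iff.2 ha) hx'

theorem isNormal_e : hg.IsNormal {hg.e} Set.univ := by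
  refine ⟨hg.isClosed_iff.2 ⟨rfl, ?_, ?_⟩, hg.isClosed_univ, Set.subset_univ _, fun p _ => ?_⟩
  · rintro x rfl
    exact hg.star_e
  · rintro x rfl y rfl
    rw [hg.idl]
  · rw [e_smul, smul_e]

theorem IsNormal.smul {F G : Set H} (hF : hg.IsNormal F Set.univ) (hG : hg.IsNormal G Set.univ) :
    hg.IsNormal (hg.smul F G) Set.univ := by
  refine ⟨hg.isClosed_iff.2 ⟨?_, ?_, ?_⟩, hg.isClosed_univ, Set.subset_univ _, fun p _ => ?_⟩
  · exact ⟨_, hF.1.e_mem, _, hG.1.e_mem, by simp [hg.idl]⟩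
  · rintro x ⟨f, hf, g, hg', hx⟩
    rw [hF.smul_comm]
    exact ⟨_, hG.1.star_mem hg', _, hF.1.star_mem hf, hg.star_mem_mul hx⟩
  · intro x hx y hy z hz
    have h : z ∈ hg.smul (hg.smul F G) (hg.smul F G) := ⟨x, hx, y, hy, hz⟩
    rw [smul_assoc, ← hg.smul_assoc G F G, ← hF.smul_comm G, hg.smul_assoc F G G,
      ← smul_assoc] at h
    exact hg.smul_mono (hF.1.smul_subset subset_rfl subset_rfl)
      (hG.1.smul_subset subset_rfl subset_rfl) h
  · rw [smul_assoc, hG.smul_comm, ← smul_assoc, hF.smul_comm, smul_assoc]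

theorem isNormal_listProd {l : List (Set H)} (h : ∀ F ∈ l, hg.IsNormal F Set.univ) :
    hg.IsNormal (hg.listProd l) Set.univ := by
  induction l with
  | nil => exact isNormal_e
  | cons F l ih =>
    exact (h F (by simp)).smul (ih fun F' hF' => h F' (by simp [hF']))

theorem listProd_append (l m : List (Set H)) :
    hg.listProd (l ++ m) = hg.smul (hg.listProd l) (hg.listProd m) := by
  induction l with
  | nil => exact (hg.e_smul _).symm
  | cons F l ih => simp only [List.cons_append, listProd, ih, smul_assoc]

theorem IsClosed.listProd_subset {G : Set H} (hG : hg.IsClosed G) {l : List (Set H)}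
    (h : ∀ F ∈ l, F ⊆ G) : hg.listProd l ⊆ G := by
  induction l with
  | nil => exact Set.singleton_subset_iff.2 hG.e_mem
  | cons F l ih =>
    exact hG.smul_subset (h F (by simp)) (ih fun F' hF' => h F' (by simp [hF']))

theorem subset_listProd {l : List (Set H)} (hl : ∀ F ∈ l, hg.e ∈ F) :
    hg.e ∈ hg.listProd l ∧ ∀ F ∈ l, F ⊆ hg.listProd l := by
  induction l with
  | nil => exact ⟨rfl, by simp⟩
  | cons F l ih =>
    obtain ⟨he, hs⟩ := ih fun F' hF' => hl F' (by simp [hF'])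
    have hF := hl F (by simp)
    refine ⟨⟨_, hF, _, he, by simp [hg.idl]⟩, fun F' hF' => ?_⟩
    rcases List.mem_cons.1 hF' with rfl | hF'
    · exact fun x hx => ⟨x, hx, _, he, by simp [hg.idr]⟩
    · exact fun x hx => ⟨_, hF, x, hs F' hF' hx, by simp [hg.idl]⟩

theorem IsDirectProduct.isClosed_cofactor {n : ℕ} {G : Fin n → Set H} (h : hg.IsDirectProduct G)
    (j : Fin n) : hg.IsClosed (hg.cofactor G j) := by
  refine (isNormal_listProd fun F hF => ?_).1
  obtain ⟨i, -, rfl⟩ := List.mem_map.1 hF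
  exact h.1 i

theorem IsDirectProduct.subset_cofactor {n : ℕ} {G : Fin n → Set H} (h : hg.IsDirectProduct G)
    {i j : Fin n} (hij : i ≠ j) : G i ⊆ hg.cofactor G j := by
  refine (subset_listProd fun F hF => ?_).2 _ (List.mem_map.2 ⟨i, by simpa using hij, rfl⟩)
  obtain ⟨i, -, rfl⟩ := List.mem_map.1 hF
  exact (h.1 i).1.e_mem

/-- A product of representatives splits as `A r_j B` with `A` and `B` inside the cofactor of `j`. -/
theorem IsDirectProduct.exists_famProd_eq {n : ℕ} {G : Fin n → Set H}
    (h : hg.IsDirectProduct G) {r : Fin n → H} (hr : ∀ i, r i ∈ G i) (j : Fin n) :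
    ∃ A B : Set H, A ⊆ hg.cofactor G j ∧ B ⊆ hg.cofactor G j ∧
      hg.famProd r = hg.smul A (hg.smul {r j} B) := by
  obtain ⟨l, m, hlm⟩ := List.append_of_mem (List.mem_finRange j)
  have hnd : (l ++ j :: m).Nodup := hlm ▸ List.nodup_finRange n
  rw [List.nodup_middle, List.nodup_cons, List.mem_append, not_or] at hnd
  have key : ∀ k : List (Fin n), j ∉ k →
      hg.listProd (k.map fun i => ({r i} : Set H)) ⊆ hg.cofactor G j := by
    intro k hk
    refine (h.isClosed_cofactor j).listProd_subset fun F hF => ?_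
    obtain ⟨i, hi, rfl⟩ := List.mem_map.1 hF
    refine Set.singleton_subset_iff.2 (h.subset_cofactor ?_ (hr i))
    rintro rfl
    exact hk hi
  refine ⟨_, _, key l hnd.1.1, key m hnd.1.2, ?_⟩
  rw [famProd, hlm, List.map_append, listProd_append, List.map_cons]
  rfl

theorem IsInvolution.star_eq {q : H} (hq : hg.IsInvolution q) : hg.star q = q := by
  have h : hg.star q ∈ ({hg.e, q} : Set H) := hq.2.star_mem (by simp)
  rcases h with h | h
  · exact absurd (by rw [← hg.star_star q, h, star_e]) hq.1
  · exact h

theorem IsInvolution.gen_subset {q : H} (hq : hg.IsInvolution q) :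
    hg.gen {q} ⊆ {hg.e, q} :=
  Set.sInter_subset_of_mem ⟨hq.2, by simp⟩

/-- If `K` has, modulo products, at most one nontrivial coset, then it cuts out a maximal
closed subset of every closed subset not contained in it. -/
theorem IsClosed.isMaximalClosed_inter {G K : Set H} (hG : hg.IsClosed G) (hK : hg.IsClosed K)
    (hGK : ¬ G ⊆ K) (hmul : ∀ z ∉ K, ∀ y ∉ K, (hg.hmul z y ∩ K).Nonempty) :
    hg.IsMaximalClosed (G ∩ K) G := by
  refine ⟨hG.inter hK, hG, Set.inter_subset_left, fun h => hGK (Set.inter_eq_left.1 h),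
    fun E hE hME hEG => ?_⟩
  by_cases hEK : E ⊆ K
  · exact Or.inl ((Set.subset_inter hEG hEK).antisymm hME)
  · obtain ⟨y, hyE, hyK⟩ := Set.not_subset.1 hEK
    refine Or.inr (hEG.antisymm fun z hzG => ?_)
    by_cases hzK : z ∈ K
    · exact hME ⟨hzG, hzK⟩
    · obtain ⟨w, hw, hwK⟩ := hmul z hzK y hyK
      exact hE.left_mem hw (hME ⟨hG.mul_mem hzG (hEG hyE) hw, hwK⟩) hyE

end Hypergroup

namespace EA2Data

open Hypergroup

variable {H : Type*} (E : EA2Data H)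

theorem q_mem_fam (i : Fin E.n) : E.q i ∈ E.fam i :=
  Set.mem_sInter.2 fun _ hC => hC.2 rfl

theorem isDirectProduct_fam : E.hg.IsDirectProduct E.fam := E.dp

theorem exists_famProd_eq_singleton (x : H) :
    ∃ r : Fin E.n → H, (∀ i, r i ∈ E.fam i) ∧ E.hg.famProd r = {x} := by
  have hx : E.hg.dcover E.fam x = {x} := E.constrained x
  obtain ⟨r, hr, hxr⟩ : x ∈ E.hg.dcover E.fam x := hx ▸ rfl
  exact ⟨r, hr.1, (hx ▸ fun y hy => ⟨r, hr, hy⟩ : E.hg.famProd r ⊆ {x}).antisymm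
    (Set.singleton_subset_iff.2 hxr)⟩

theorem eq_e_or_eq_q {i : Fin E.n} {x : H} (hx : x ∈ E.fam i) : x = E.hg.e ∨ x = E.q i :=
  (E.invol i).gen_subset hx

theorem q_notMem_cofactor (j : Fin E.n) : E.q j ∉ E.hg.cofactor E.fam j := fun h =>
  (E.invol j).1 (by
    have := E.isDirectProduct_fam.2.2 j
    exact (this ▸ ⟨E.q_mem_fam j, h⟩ : E.q j ∈ ({E.hg.e} : Set H)))

/-- A nontrivial element lies outside some cofactor. -/
theorem exists_notMem_cofactor {x : H} (hx : x ≠ E.hg.e) :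
    ∃ j, x ∉ E.hg.cofactor E.fam j := by
  by_contra! hall
  obtain ⟨r, hr, hrx⟩ := E.exists_famProd_eq_singleton x
  have hre : ∀ j, r j = E.hg.e := by
    intro j
    have hK := E.isDirectProduct_fam.isClosed_cofactor j
    obtain ⟨A, B, hA, hB, hAB⟩ := E.isDirectProduct_fam.exists_famProd_eq hr j
    obtain ⟨a, ha, c, ⟨_, rfl, b, hb, hc⟩, hxc⟩ :
        x ∈ E.hg.smul A (E.hg.smul {r j} B) := by rw [← hAB, hrx]; rfl
    have hj := hK.left_mem hc (hK.right_mem hxc (hall j) (hA ha)) (hB hb)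
    exact (E.eq_e_or_eq_q (hr j)).resolve_right fun h => E.q_notMem_cofactor j (h ▸ hj)
  have hsub : E.hg.famProd r ⊆ {E.hg.e} := by
    refine isNormal_e.1.listProd_subset fun F hF => ?_
    obtain ⟨i, -, rfl⟩ := List.mem_map.1 hF
    simp [hre i]
  exact hx (hsub (hrx ▸ rfl))

/-- Conjugating an element of the cofactor by `q_j` yields that element again. -/
theorem mem_q_smul_q {j : Fin E.n} {c : H} (hc : c ∈ E.hg.cofactor E.fam j) :
    c ∈ E.hg.smul {E.q j} (E.hg.smul {c} {E.q j}) := by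
  have hK := E.isDirectProduct_fam.isClosed_cofactor j
  obtain ⟨d, hd⟩ := E.hg.hmul_nonempty (E.q j) c
  have hdK : d ∉ E.hg.cofactor E.fam j := fun h => E.q_notMem_cofactor j (hK.left_mem hd h hc)
  obtain ⟨_, rfl, f, hf, hdf⟩ : d ∈ E.hg.smul {c} (E.fam j) := by
    rw [← (E.isDirectProduct_fam.1 j).smul_comm]
    exact ⟨_, E.q_mem_fam j, _, rfl, hd⟩
  obtain rfl : f = E.q j := (E.eq_e_or_eq_q hf).resolve_left fun h =>
    hdK (hK.mul_mem hc (h ▸ hK.e_mem) hdf)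
  have h := (E.hg.h3l _ _ _).1 hdf
  rw [(E.invol j).star_eq] at h
  rw [← smul_assoc]
  exact ⟨d, ⟨_, rfl, _, rfl, hd⟩, _, rfl, h⟩

/-- An element outside the cofactor of `j` is a product `A q_j B`. -/
theorem exists_singleton_eq {j : Fin E.n} {y : H} (hy : y ∉ E.hg.cofactor E.fam j) :
    ∃ A B : Set H, A ⊆ E.hg.cofactor E.fam j ∧ B ⊆ E.hg.cofactor E.fam j ∧
      {y} = E.hg.smul A (E.hg.smul {E.q j} B) := by
  have hK := E.isDirectProduct_fam.isClosed_cofactor j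
  obtain ⟨r, hr, hry⟩ := E.exists_famProd_eq_singleton y
  obtain ⟨A, B, hA, hB, hAB⟩ := E.isDirectProduct_fam.exists_famProd_eq hr j
  rw [hry] at hAB
  rcases E.eq_e_or_eq_q (hr j) with h | h
  · rw [h, e_smul] at hAB
    exact absurd (hK.smul_subset hA hB (hAB ▸ rfl)) hy
  · exact ⟨A, B, hA, hB, h ▸ hAB⟩

theorem hmul_inter_cofactor_nonempty {j : Fin E.n} {z y : H}
    (hz : z ∉ E.hg.cofactor E.fam j) (hy : y ∉ E.hg.cofactor E.fam j) :
    (E.hg.hmul z y ∩ E.hg.cofactor E.fam j).Nonempty := by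
  have hK := E.isDirectProduct_fam.isClosed_cofactor j
  obtain ⟨A, B, hA, hB, hAB⟩ := E.exists_singleton_eq hz
  obtain ⟨C, D, hC, hD, hCD⟩ := E.exists_singleton_eq hy
  obtain ⟨a, ha, _, ⟨_, -, b, hb, -⟩, -⟩ : z ∈ E.hg.smul A (E.hg.smul {E.q j} B) := hAB ▸ rfl
  obtain ⟨c, hc, _, ⟨_, -, d, hd, -⟩, -⟩ : y ∈ E.hg.smul C (E.hg.smul {E.q j} D) := hCD ▸ rfl
  obtain ⟨k, hk⟩ := E.hg.hmul_nonempty b c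
  have hkK := hK.mul_mem (hB hb) (hC hc) hk
  obtain ⟨m, hm⟩ := E.hg.hmul_nonempty k d
  have hmK := hK.mul_mem hkK (hD hd) hm
  obtain ⟨w, hw⟩ := E.hg.hmul_nonempty a m
  refine ⟨w, ?_, hK.mul_mem (hA ha) hmK hw⟩
  have hkBC : ({k} : Set H) ⊆ E.hg.smul B C :=
    Set.singleton_subset_iff.2 ⟨b, hb, c, hc, hk⟩
  have hkq : k ∈ E.hg.smul {E.q j} (E.hg.smul (E.hg.smul B C) {E.q j}) :=
    E.hg.smul_mono subset_rfl (E.hg.smul_mono hkBC subset_rfl) (E.mem_q_smul_q hkK)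
  have hwzy : w ∈ E.hg.smul {z} {y} := by
    rw [hAB, hCD]
    have : w ∈ E.hg.smul A (E.hg.smul
        (E.hg.smul {E.q j} (E.hg.smul (E.hg.smul B C) {E.q j})) D) :=
      ⟨a, ha, m, ⟨k, hkq, d, hd, hm⟩, hw⟩
    simpa only [smul_assoc] using this
  obtain ⟨_, rfl, _, rfl, h⟩ := hwzy
  exact h

theorem frattini_eq {G : Set H} (hG : E.hg.IsClosed G) : E.hg.frattini G = {E.hg.e} := by
  refine Set.Subset.antisymm ?_ (Set.singleton_subset_iff.2
    ⟨hG.e_mem, Set.mem_sInter.2 fun F hF => hF.1.e_mem⟩)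
  rintro x ⟨hxG, hx⟩
  by_contra hxe
  obtain ⟨j, hj⟩ := E.exists_notMem_cofactor hxe
  exact hj (Set.mem_sInter.1 hx _ (hG.isMaximalClosed_inter
    (E.isDirectProduct_fam.isClosed_cofactor j) (fun h => hj (h hxG))
    fun z hz y hy => E.hmul_inter_cofactor_nonempty hz hy)).2

end EA2Data

end HyperPaper

/-- For a closed subset G of an elementary abelian 2-hypergroup H, the
Frattini closed subset of G equals {e}; in particular the Frattini closed subset of H
equals {e}. -/
theorem stmt11 {H : Type*} (E : EA2Data H) (G : Set H) (hG : E.hg.IsClosed G) :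
    E.hg.frattini G = {E.hg.e} ∧ E.hg.frattini (Set.univ : Set H) = {E.hg.e} := by
  exact ⟨E.frattini_eq hG, E.frattini_eq E.hg.isClosed_univ⟩
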